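/- Let d ≥ 1, let f : ℝ^d → ℝ be continuously differentiable, let x_1, …, x_N ∈ [0,1]^d, and let W ≥ 0 be an ∞-transport bound for the pair (μ_N, Lebesgue measure restricted to [0,1]^d), where μ_N = (1/N)∑_{k=1}^N δ_{x_k}. Then there is a constant c_d > 0 depending only on d such that |∫_{[0,1]^d} f(x) dx − (1/N)∑_{k=1}^N f(x_k)| ≤ c_d · ‖∇f‖_{L^∞([0,1]^d)}^{(d−1)/d} · ‖∇f‖_{L^1([0,1]^d)}^{1/d} · N · W^{d+1}. -/

import Mathlib

open MeasureTheory Metric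
open scoped ENNReal

noncomputable section

/-- The closed unit cube `[0,1]^d` in `ℝ^d`. -/
def unitCube (d : ℕ) : Set (EuclideanSpace ℝ (Fin d)) :=
  {x | ∀ i, x i ∈ Set.Icc (0 : ℝ) 1}

/-- The empirical measure `(1/N) ∑ δ_{x k}`. -/
def empiricalMeasure (d N : ℕ) (x : Fin N → EuclideanSpace ℝ (Fin d)) :
    Measure (EuclideanSpace ℝ (Fin d)) :=
  ((N : ℝ≥0∞))⁻¹ • ∑ k, MeasureTheory.Measure.dirac (x k)

/-- `W` is an `∞`-transport bound for `(μ, ν)`: there is a coupling of `μ` and `ν`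
which moves no mass further than `W`. -/
def IsInfTransportBound {d : ℕ} (μ ν : Measure (EuclideanSpace ℝ (Fin d))) (W : ℝ) : Prop :=
  ∃ π : Measure (EuclideanSpace ℝ (Fin d) × EuclideanSpace ℝ (Fin d)),
    π.map Prod.fst = μ ∧ π.map Prod.snd = ν ∧ π {p | W < dist p.1 p.2} = 0

lemma bracket_bound (m : ℕ) (r W s : ℝ) (hr : 0 ≤ r) (hW : 0 ≤ W) (hs : 0 < s) :
    ∫⁻ t in Set.Ioc s 1, (if r ≤ t * W then ENNReal.ofReal (t⁻¹ * (t ^ (m + 1))⁻¹ * r) else 0) ≤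
      ENNReal.ofReal (W * (s ^ m)⁻¹) := by
  rcases hr.eq_or_lt with rfl | hr
  · simp
  rcases hW.eq_or_lt with rfl | hW
  · simp [hr.not_ge]
  have hc : 0 < r / W := by positivity
  have hint := integrableOn_Ioi_rpow_of_lt (a := -2) (c := r / W) (by norm_num) hc
  have hval := integral_Ioi_rpow_of_lt (a := -2) (by norm_num) hc
  calc ∫⁻ t in Set.Ioc s 1, (if r ≤ t * W then ENNReal.ofReal (t⁻¹ * (t ^ (m + 1))⁻¹ * r) else 0)
      ≤ ∫⁻ t in Set.Ioc s 1, (Set.Ici (r / W)).indicator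
          (fun t => ENNReal.ofReal (r * (s ^ m)⁻¹ * t ^ (-2 : ℝ))) t := by
        refine setLIntegral_mono' measurableSet_Ioc fun t ht => ?_
        have ht0 : 0 < t := hs.trans ht.1
        split_ifs with h
        · have : t ∈ Set.Ici (r / W) := by
            rw [Set.mem_Ici, div_le_iff₀ hW]; exact h
          rw [Set.indicator_of_mem this]
          refine ENNReal.ofReal_le_ofReal ?_
          have e : t ^ (-2 : ℝ) = (t ^ 2)⁻¹ := by
            rw [Real.rpow_neg ht0.le]; norm_num
          have e2 : t⁻¹ * (t ^ (m + 1))⁻¹ * r = r * (t ^ m)⁻¹ * (t ^ 2)⁻¹ := by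
            field_simp; ring
          rw [e, e2]
          gcongr
          exact ht.1.le
        · exact zero_le
    _ ≤ ∫⁻ t, (Set.Ici (r / W)).indicator
          (fun t => ENNReal.ofReal (r * (s ^ m)⁻¹ * t ^ (-2 : ℝ))) t := setLIntegral_le_lintegral _ _
    _ = ∫⁻ t in Set.Ioi (r / W), ENNReal.ofReal (r * (s ^ m)⁻¹ * t ^ (-2 : ℝ)) := by
        rw [lintegral_indicator measurableSet_Ici, setLIntegral_congr Ioi_ae_eq_Ici.symm]
    _ = ENNReal.ofReal (∫ t in Set.Ioi (r / W), r * (s ^ m)⁻¹ * t ^ (-2 : ℝ)) := by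
        rw [ofReal_integral_eq_lintegral_ofReal (hint.const_mul _)]
        filter_upwards [ae_restrict_mem measurableSet_Ioi] with t ht
        have : 0 < t := hc.trans ht
        simp only [Pi.zero_apply]
        positivity
    _ ≤ _ := by
        refine ENNReal.ofReal_le_ofReal (le_of_eq ?_)
        rw [integral_const_mul, hval]
        norm_num
        rw [Real.rpow_neg hc.le, Real.rpow_one]
        field_simp

lemma scale_lint {E : Type*} [NormedAddCommGroup E] [NormedSpace ℝ E] [MeasurableSpace E]
    [BorelSpace E] [FiniteDimensional ℝ E] (μ : Measure E) [μ.IsAddHaarMeasure]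
    (F : E → ℝ≥0∞) (hF : Measurable F) (z : E) (t : ℝ) (ht : 0 < t) :
    ∫⁻ y, F (z + t • (y - z)) ∂μ =
      ENNReal.ofReal ((t ^ Module.finrank ℝ E)⁻¹) * ∫⁻ u, F u ∂μ := by
  rw [lintegral_sub_right_eq_self (fun y => F (z + t • y)) z]
  have h1 : Measurable (fun u => F (z + u)) := hF.comp (measurable_const_add z)
  have h2 := lintegral_map (μ := μ) h1 (measurable_const_smul t)
  rw [← h2, Measure.map_addHaar_smul μ ht.ne', lintegral_smul_measure,
    lintegral_add_left_eq_self, abs_of_pos (by positivity)]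
  rfl

lemma ftc_bound {E : Type*} [NormedAddCommGroup E] [NormedSpace ℝ E]
    (f : E → ℝ) (hf : ContDiff ℝ 1 f) (y z : E) (s : ℝ) (hs1 : s ≤ 1) :
    ‖f y - f (z + s • (y - z))‖ₑ ≤
      ∫⁻ t in Set.Ioc s 1, ‖fderiv ℝ f (z + t • (y - z))‖ₑ * ‖y - z‖ₑ := by
  have hg : Continuous (fderiv ℝ f) := hf.continuous_fderiv (by norm_num)
  have hd : ∀ t : ℝ, HasDerivAt (fun t : ℝ => f (z + t • (y - z)))
      (fderiv ℝ f (z + t • (y - z)) (y - z)) t := by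
    intro t
    have h1 : HasDerivAt (fun t : ℝ => z + t • (y - z)) (y - z) t := by
      simpa using ((hasDerivAt_id t).smul_const (y - z)).const_add z
    exact ((hf.differentiable (by norm_num)) _).hasFDerivAt.comp_hasDerivAt t h1
  have hcont : Continuous fun t : ℝ => fderiv ℝ f (z + t • (y - z)) (y - z) := by fun_prop
  have h := intervalIntegral.integral_eq_sub_of_hasDerivAt (fun t _ => hd t)
    (hcont.intervalIntegrable s 1)
  have e : z + (1 : ℝ) • (y - z) = y := by simp
  rw [e] at h
  rw [← h, intervalIntegral.integral_of_le hs1]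
  refine (enorm_integral_le_lintegral_enorm _).trans ?_
  refine lintegral_mono fun t => ?_
  exact ContinuousLinearMap.le_opENorm _ _

lemma double_bound {E : Type*} [NormedAddCommGroup E] [NormedSpace ℝ E] [MeasurableSpace E]
    [BorelSpace E] [FiniteDimensional ℝ E] (μ : Measure E) [μ.IsAddHaarMeasure]
    (m : ℕ) (hm : Module.finrank ℝ E = m + 1)
    (Q : Set E) (hQ : Convex ℝ Q) (hQm : MeasurableSet Q)
    (g : E → ℝ≥0∞) (hg : Measurable g) (z : E) (hz : z ∈ Q) (W s : ℝ) (hW : 0 ≤ W) (hs : 0 < s) :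
    ∫⁻ y in Q ∩ closedBall z W, (∫⁻ t in Set.Ioc s 1, g (z + t • (y - z)) * ‖y - z‖ₑ) ∂μ ≤
      ENNReal.ofReal (W * (s ^ m)⁻¹) * ∫⁻ u in Q ∩ closedBall z W, g u ∂μ := by
  classical
  set S := Q ∩ closedBall z W with hS
  have hSm : MeasurableSet S := hQm.inter measurableSet_closedBall
  let F : ℝ → E → ℝ≥0∞ := fun t u =>
    S.indicator g u * (if ‖u - z‖ ≤ t * W then ENNReal.ofReal (t⁻¹ * ‖u - z‖) else 0)
  have hFm : Measurable (Function.uncurry F) := by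
    refine ((hg.indicator hSm).comp measurable_snd).mul ?_
    refine Measurable.ite ?_ (by fun_prop) measurable_const
    exact measurableSet_le (by fun_prop) (by fun_prop)
  have hFt : ∀ t, Measurable (F t) := fun t => hFm.comp measurable_prodMk_left
  calc _ = ∫⁻ t in Set.Ioc s 1, ∫⁻ y in S, g (z + t • (y - z)) * ‖y - z‖ₑ ∂μ := by
        refine lintegral_lintegral_swap ?_
        refine Measurable.aemeasurable ?_
        refine Measurable.mul (hg.comp ?_) ?_
        · exact Continuous.measurable (by fun_prop)
        · exact Continuous.measurable (by fun_prop)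
    _ ≤ ∫⁻ t in Set.Ioc s 1, ENNReal.ofReal ((t ^ (m + 1))⁻¹) * ∫⁻ u, F t u ∂μ := by
        refine setLIntegral_mono' measurableSet_Ioc fun t ht => ?_
        have ht0 : 0 < t := hs.trans ht.1
        rw [← hm, ← scale_lint μ (F t) (hFt t) z t ht0]
        refine le_trans ?_ (setLIntegral_le_lintegral S _)
        refine setLIntegral_mono' hSm fun y hy => ?_
        have hyW : ‖y - z‖ ≤ W := by simpa [dist_eq_norm] using hy.2
        have hn : ‖t • (y - z)‖ = t * ‖y - z‖ := by rw [norm_smul, Real.norm_of_nonneg ht0.le]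
        have h1 : z + t • (y - z) ∈ S := by
          refine ⟨hQ.add_smul_sub_mem hz hy.1 ⟨ht0.le, ht.2⟩, ?_⟩
          rw [mem_closedBall, dist_eq_norm, add_sub_cancel_left, hn]
          nlinarith [norm_nonneg (y - z), ht.2]
        simp only [F]
        rw [Set.indicator_of_mem h1, add_sub_cancel_left, hn, if_pos (by gcongr),
          inv_mul_cancel_left₀ ht0.ne', ofReal_norm]
    _ = ∫⁻ t in Set.Ioc s 1, ∫⁻ u, ENNReal.ofReal ((t ^ (m + 1))⁻¹) * F t u ∂μ := by
        refine lintegral_congr fun t => ?_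
        rw [lintegral_const_mul _ (hFt t)]
    _ = ∫⁻ u, (∫⁻ t in Set.Ioc s 1, ENNReal.ofReal ((t ^ (m + 1))⁻¹) * F t u) ∂μ := by
        refine lintegral_lintegral_swap (Measurable.aemeasurable ?_)
        exact Measurable.mul (by fun_prop) hFm
    _ ≤ ∫⁻ u, S.indicator g u * ENNReal.ofReal (W * (s ^ m)⁻¹) ∂μ := by
        refine lintegral_mono fun u => ?_
        refine le_trans ?_ (mul_le_mul_right (bracket_bound m ‖u - z‖ W s (norm_nonneg _) hW hs) _)
        rw [← lintegral_const_mul]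
        · refine setLIntegral_mono' measurableSet_Ioc fun t ht => ?_
          have ht0 : 0 < t := hs.trans ht.1
          simp only [F]
          rw [mul_left_comm]
          refine mul_le_mul_right (le_of_eq ?_) _
          split_ifs
          · rw [← ENNReal.ofReal_mul (by positivity)]
            congr 1; ring
          · simp
        · refine Measurable.ite ?_ (by fun_prop) measurable_const
          exact measurableSet_le (by fun_prop) (by fun_prop)
    _ = _ := by
        rw [lintegral_mul_const _ (hg.indicator hSm), lintegral_indicator hSm, mul_comm]

lemma point_bound {E : Type*} [NormedAddCommGroup E] [NormedSpace ℝ E] [MeasurableSpace E]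
    [BorelSpace E] [FiniteDimensional ℝ E] (μ : Measure E) [μ.IsAddHaarMeasure]
    (m : ℕ) (hm : Module.finrank ℝ E = m + 1)
    (Q : Set E) (hQ : Convex ℝ Q) (hQm : MeasurableSet Q)
    (f : E → ℝ) (hf : ContDiff ℝ 1 f) (L : ℝ) (hL0 : 0 ≤ L) (hL : ∀ y ∈ Q, ‖fderiv ℝ f y‖ ≤ L)
    (z : E) (hz : z ∈ Q) (W s : ℝ) (hW : 0 ≤ W) (hs : 0 < s) (hs1 : s ≤ 1) :
    ∫⁻ y in Q ∩ closedBall z W, ‖f y - f z‖ₑ ∂μ ≤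
      ENNReal.ofReal (L * s * W) * μ (closedBall z W) +
      ENNReal.ofReal (W * (s ^ m)⁻¹) * ∫⁻ u in Q ∩ closedBall z W, ‖fderiv ℝ f u‖ₑ ∂μ := by
  have hSm : MeasurableSet (Q ∩ closedBall z W) := hQm.inter measurableSet_closedBall
  have hg : Continuous (fderiv ℝ f) := hf.continuous_fderiv (by norm_num)
  calc _ ≤ ∫⁻ y in Q ∩ closedBall z W, (ENNReal.ofReal (L * s * W) +
        ∫⁻ t in Set.Ioc s 1, ‖fderiv ℝ f (z + t • (y - z))‖ₑ * ‖y - z‖ₑ) ∂μ := by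
        refine setLIntegral_mono' hSm fun y hy => ?_
        have h0 : f y - f z = (f (z + s • (y - z)) - f z) + (f y - f (z + s • (y - z))) := by ring
        rw [h0]
        refine (enorm_add_le _ _).trans (add_le_add ?_ (ftc_bound f hf y z s hs1))
        have hyW : ‖y - z‖ ≤ W := by simpa [dist_eq_norm] using hy.2
        rw [← ofReal_norm]
        refine ENNReal.ofReal_le_ofReal ?_
        have h1 : z + s • (y - z) ∈ Q := hQ.add_smul_sub_mem hz hy.1 ⟨hs.le, hs1⟩
        have := hQ.norm_image_sub_le_of_norm_fderiv_le
          (fun x _ => (hf.differentiable (by norm_num)) x) hL hz h1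
        refine this.trans ?_
        rw [add_sub_cancel_left, norm_smul, Real.norm_of_nonneg hs.le, ← mul_assoc]
        gcongr
    _ ≤ _ := by
        rw [lintegral_add_left measurable_const, setLIntegral_const]
        refine add_le_add (mul_le_mul_right (measure_mono Set.inter_subset_right) _) ?_
        exact double_bound μ m hm Q hQ hQm _ hg.enorm.measurable z hz W s hW hs

lemma unitCube_eq (d : ℕ) : unitCube d =
    (EuclideanSpace.equiv (Fin d) ℝ) ⁻¹' (Set.univ.pi fun _ => Set.Icc (0 : ℝ) 1) := by
  ext x
  simp only [unitCube, Set.mem_preimage, Set.mem_pi, Set.mem_univ, true_implies, Set.mem_setOf_eq]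
  rfl

lemma unitCube_convex (d : ℕ) : Convex ℝ (unitCube d) := by
  rw [unitCube_eq]
  exact (convex_pi fun _ _ => convex_Icc 0 1).linear_preimage
    (EuclideanSpace.equiv (Fin d) ℝ).toLinearEquiv.toLinearMap

lemma unitCube_compact (d : ℕ) : IsCompact (unitCube d) := by
  rw [unitCube_eq]
  exact (EuclideanSpace.equiv (Fin d) ℝ).toHomeomorph.isCompact_preimage.2
    (isCompact_univ_pi fun _ => isCompact_Icc)

lemma empirical_ae (d N : ℕ) (x : Fin N → EuclideanSpace ℝ (Fin d)) :
    ∀ᵐ y ∂(empiricalMeasure d N x), y ∈ Set.range x := by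
  rw [ae_iff]
  simp only [empiricalMeasure, Measure.smul_apply, Measure.finsetSum_apply]
  have : MeasurableSet {a | a ∉ Set.range x} :=
    (Set.finite_range x).measurableSet.compl
  simp [Measure.dirac_apply' _ this, Set.indicator]

lemma transport_bound (d N : ℕ) (hN : 0 < N) (x : Fin N → EuclideanSpace ℝ (Fin d)) (W : ℝ)
    (h : IsInfTransportBound (empiricalMeasure d N x) (volume.restrict (unitCube d)) W)
    (f : EuclideanSpace ℝ (Fin d) → ℝ) (hf : Continuous f) :
    ‖(∫ y in unitCube d, f y) - (1 / N : ℝ) * ∑ k, f (x k)‖ₑ ≤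
      ∑ k, ∫⁻ y in unitCube d ∩ closedBall (x k) W, ‖f y - f (x k)‖ₑ := by
  obtain ⟨π, h1, h2, h3⟩ := h
  have hN' : (N : ℝ≥0∞) ≠ 0 := by exact_mod_cast hN.ne'
  have hI2 : Integrable f (π.map Prod.snd) := by
    rw [h2]; exact hf.continuousOn.integrableOn_compact (unitCube_compact d)
  have hI1 : Integrable f (π.map Prod.fst) := by
    rw [h1]
    refine Integrable.smul_measure ?_ (by simpa using hN')
    rw [integrable_finsetSum_measure]
    intro i _
    exact integrable_dirac (by simp)
  have e1 : (1 / N : ℝ) * ∑ k, f (x k) = ∫ p, f p.1 ∂π := by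
    rw [← integral_map measurable_fst.aemeasurable hI1.1, h1, empiricalMeasure,
      integral_smul_measure, integral_finsetSum_measure]
    · simp [integral_dirac]
    · intro i _
      exact integrable_dirac (by simp)
  have e2 : ∫ y in unitCube d, f y = ∫ p, f p.2 ∂π := by
    rw [← integral_map measurable_snd.aemeasurable hI2.1, h2]
  have i2 : Integrable (fun p => f p.2) π := hI2.comp_measurable measurable_snd
  have i1 : Integrable (fun p => f p.1) π := hI1.comp_measurable measurable_fst
  rw [e1, e2, ← integral_sub i2 i1]
  refine (enorm_integral_le_lintegral_enorm _).trans ?_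
  have hG : ∀ k, Measurable ((closedBall (x k) W).indicator fun y => ‖f y - f (x k)‖ₑ) :=
    fun k => (Continuous.measurable (by fun_prop)).indicator measurableSet_closedBall
  calc _ ≤ ∫⁻ p, ∑ k, (closedBall (x k) W).indicator (fun y => ‖f y - f (x k)‖ₑ) p.2 ∂π := by
        refine lintegral_mono_ae ?_
        have a1 : ∀ᵐ p ∂π, p.1 ∈ Set.range x :=
          ae_of_ae_map measurable_fst.aemeasurable (h1 ▸ empirical_ae d N x)
        have a2 : ∀ᵐ p ∂π, dist p.1 p.2 ≤ W := by
          rw [ae_iff]; simpa using h3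
        filter_upwards [a1, a2] with p hp1 hp2
        obtain ⟨k, hk⟩ := hp1
        refine le_trans ?_ (Finset.single_le_sum (fun i _ => zero_le) (Finset.mem_univ k))
        rw [Set.indicator_of_mem, hk]
        rw [mem_closedBall, hk, dist_comm]; exact hp2
    _ = ∫⁻ y, ∑ k, (closedBall (x k) W).indicator (fun y => ‖f y - f (x k)‖ₑ) y
          ∂(π.map Prod.snd) := by
        rw [lintegral_map (Finset.measurable_fun_sum _ fun k _ => hG k) measurable_snd]
    _ = _ := by
        rw [h2, lintegral_finsetSum _ fun k _ => hG k]
        refine Finset.sum_congr rfl fun k _ => ?_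
        rw [lintegral_indicator measurableSet_closedBall, Measure.restrict_restrict
          measurableSet_closedBall, Set.inter_comm]

lemma count_bound (d N : ℕ) (hN : 0 < N) (x : Fin N → EuclideanSpace ℝ (Fin d)) (W : ℝ)
    (h : IsInfTransportBound (empiricalMeasure d N x) (volume.restrict (unitCube d)) W)
    (y : EuclideanSpace ℝ (Fin d)) :
    ∑ k, (closedBall (x k) W).indicator (fun _ => (1 : ℝ≥0∞)) y ≤
      N * volume (closedBall y (2 * W)) := by
  obtain ⟨π, h1, h2, h3⟩ := h
  have hN' : (N : ℝ≥0∞) ≠ 0 := by exact_mod_cast hN.ne'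
  have key : empiricalMeasure d N x (closedBall y W) ≤ volume (closedBall y (2 * W)) := by
    calc _ = π (Prod.fst ⁻¹' closedBall y W) := by
          rw [← h1, Measure.map_apply measurable_fst measurableSet_closedBall]
      _ ≤ π (Prod.snd ⁻¹' closedBall y (2 * W) ∪ {p | W < dist p.1 p.2}) := by
          refine measure_mono fun p hp => ?_
          by_cases hq : W < dist p.1 p.2
          · exact Or.inr hq
          · left
            simp only [Set.mem_preimage, mem_closedBall] at hp ⊢
            have := dist_triangle p.2 p.1 y
            rw [dist_comm p.2 p.1] at this
            linarith
      _ ≤ π (Prod.snd ⁻¹' closedBall y (2 * W)) + 0 := by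
          rw [← h3]; exact measure_union_le _ _
      _ = volume.restrict (unitCube d) (closedBall y (2 * W)) := by
          rw [← h2, Measure.map_apply measurable_snd measurableSet_closedBall, add_zero]
      _ ≤ _ := Measure.restrict_apply_le _ _
  have e : empiricalMeasure d N x (closedBall y W) =
      (N : ℝ≥0∞)⁻¹ * ∑ k, (closedBall (x k) W).indicator (fun _ => (1 : ℝ≥0∞)) y := by
    simp only [empiricalMeasure, Measure.smul_apply, Measure.finsetSum_apply, smul_eq_mul]
    congr 1
    refine Finset.sum_congr rfl fun k _ => ?_
    rw [Measure.dirac_apply' _ measurableSet_closedBall]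
    simp only [Set.indicator, mem_closedBall, dist_comm y, Pi.one_apply]
  rw [e] at key
  calc _ = (N : ℝ≥0∞) * ((N : ℝ≥0∞)⁻¹ *
        ∑ k, (closedBall (x k) W).indicator (fun _ => (1 : ℝ≥0∞)) y) := by
        rw [← mul_assoc, ENNReal.mul_inv_cancel hN' (by simp), one_mul]
    _ ≤ _ := by gcongr

lemma mass_one (d N : ℕ) (hN : 0 < N) (x : Fin N → EuclideanSpace ℝ (Fin d)) (W : ℝ)
    (h : IsInfTransportBound (empiricalMeasure d N x) (volume.restrict (unitCube d)) W) :
    volume (unitCube d) = 1 := by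
  obtain ⟨π, h1, h2, h3⟩ := h
  have hN' : (N : ℝ≥0∞) ≠ 0 := by exact_mod_cast hN.ne'
  have a : (π.map Prod.snd) Set.univ = (π.map Prod.fst) Set.univ := by
    rw [Measure.map_apply measurable_snd MeasurableSet.univ,
      Measure.map_apply measurable_fst MeasurableSet.univ]
    rfl
  rw [h1, h2] at a
  simp only [Measure.restrict_apply_univ, empiricalMeasure, Measure.smul_apply,
    Measure.finsetSum_apply, smul_eq_mul, measure_univ] at a
  rw [a]
  simp [ENNReal.inv_mul_cancel hN']

lemma sum_bound (d m N : ℕ) (hdm : d = m + 1) (hN : 0 < N)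
    (x : Fin N → EuclideanSpace ℝ (Fin d)) (hx : ∀ k, x k ∈ unitCube d) (W : ℝ) (hW : 0 ≤ W)
    (h : IsInfTransportBound (empiricalMeasure d N x) (volume.restrict (unitCube d)) W)
    (f : EuclideanSpace ℝ (Fin d) → ℝ) (hf : ContDiff ℝ 1 f)
    (L : ℝ) (hL0 : 0 ≤ L) (hL : ∀ y ∈ unitCube d, ‖fderiv ℝ f y‖ ≤ L)
    (s : ℝ) (hs : 0 < s) (hs1 : s ≤ 1) :
    |(∫ y in unitCube d, f y) - (1 / N : ℝ) * ∑ k, f (x k)| ≤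
      (volume (ball (0 : EuclideanSpace ℝ (Fin d)) 1)).toReal * N * W ^ (d + 1) *
        (L * s + 2 ^ d * ((s ^ m)⁻¹ * ∫ y in unitCube d, ‖fderiv ℝ f y‖)) := by
  have hg : Continuous (fderiv ℝ f) := hf.continuous_fderiv (by norm_num)
  have hrank : Module.finrank ℝ (EuclideanSpace ℝ (Fin d)) = d := by simp
  have hQm : MeasurableSet (unitCube d) := (unitCube_compact d).measurableSet
  set V := (volume (ball (0 : EuclideanSpace ℝ (Fin d)) 1)).toReal with hV
  have hVe : volume (ball (0 : EuclideanSpace ℝ (Fin d)) 1) = ENNReal.ofReal V :=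
    (ENNReal.ofReal_toReal measure_ball_lt_top.ne).symm
  have hV0 : 0 ≤ V := ENNReal.toReal_nonneg
  set I := ∫ y in unitCube d, ‖fderiv ℝ f y‖ with hI
  have hI0 : 0 ≤ I := integral_nonneg fun _ => norm_nonneg _
  have hIe : ∫⁻ y in unitCube d, ‖fderiv ℝ f y‖ₑ = ENNReal.ofReal I := by
    rw [hI, ofReal_integral_eq_lintegral_ofReal
      (hg.norm.continuousOn.integrableOn_compact (unitCube_compact d))
      (Filter.Eventually.of_forall fun _ => norm_nonneg _)]
    simp
  have hball : ∀ (z : EuclideanSpace ℝ (Fin d)) (r : ℝ), 0 ≤ r →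
      volume (closedBall z r) = ENNReal.ofReal (r ^ d * V) := by
    intro z r hr
    rw [Measure.addHaar_closedBall volume z hr, hrank, hVe, ← ENNReal.ofReal_mul (by positivity)]
  have hcount : ∑ k, ∫⁻ u in unitCube d ∩ closedBall (x k) W, ‖fderiv ℝ f u‖ₑ ≤
      ENNReal.ofReal (N * ((2 * W) ^ d * V) * I) := by
    calc _ = ∫⁻ u in unitCube d, ∑ k,
            (closedBall (x k) W).indicator (fun _ => (1 : ℝ≥0∞)) u * ‖fderiv ℝ f u‖ₑ := by
          rw [lintegral_finsetSum]
          · refine Finset.sum_congr rfl fun k _ => ?_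
            rw [Set.inter_comm, ← Measure.restrict_restrict measurableSet_closedBall,
              ← lintegral_indicator measurableSet_closedBall]
            refine lintegral_congr fun u => ?_
            by_cases hu : u ∈ closedBall (x k) W <;> simp [hu]
          · intro k _
            exact (measurable_const.indicator measurableSet_closedBall).mul hg.enorm.measurable
      _ ≤ ∫⁻ u in unitCube d, ENNReal.ofReal (N * ((2 * W) ^ d * V)) * ‖fderiv ℝ f u‖ₑ := by
          refine lintegral_mono fun u => ?_
          simp only
          rw [← Finset.sum_mul]
          refine mul_le_mul_left ((count_bound d N hN x W h u).trans (le_of_eq ?_)) _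
          rw [hball _ _ (by positivity), ENNReal.ofReal_mul (p := (N : ℝ)) (by positivity), ENNReal.ofReal_natCast]
      _ = _ := by
          rw [lintegral_const_mul _ hg.enorm.measurable, hIe, ← ENNReal.ofReal_mul (by positivity)]
  have main : ENNReal.ofReal |(∫ y in unitCube d, f y) - (1 / N : ℝ) * ∑ k, f (x k)| ≤
      ENNReal.ofReal (V * N * W ^ (d + 1) * (L * s + 2 ^ d * ((s ^ m)⁻¹ * I))) := by
    rw [← Real.norm_eq_abs, ofReal_norm]
    calc _ ≤ ∑ k, ∫⁻ y in unitCube d ∩ closedBall (x k) W, ‖f y - f (x k)‖ₑ :=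
          transport_bound d N hN x W h f hf.continuous
      _ ≤ ∑ k, (ENNReal.ofReal (L * s * W) * volume (closedBall (x k) W) +
            ENNReal.ofReal (W * (s ^ m)⁻¹) *
              ∫⁻ u in unitCube d ∩ closedBall (x k) W, ‖fderiv ℝ f u‖ₑ) := by
          refine Finset.sum_le_sum fun k _ => ?_
          exact point_bound volume m (hrank.trans hdm) (unitCube d) (unitCube_convex d) hQm f hf L
            hL0 hL (x k) (hx k) W s hW hs hs1
      _ ≤ ENNReal.ofReal (N * (L * s * W * (W ^ d * V))) +
            ENNReal.ofReal (W * (s ^ m)⁻¹ * (N * ((2 * W) ^ d * V) * I)) := by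
          rw [Finset.sum_add_distrib, ← Finset.mul_sum, ← Finset.mul_sum]
          refine add_le_add (le_of_eq ?_) ?_
          · simp only [hball _ W hW, Finset.sum_const, Finset.card_univ, Fintype.card_fin,
              nsmul_eq_mul]
            rw [mul_left_comm, ← ENNReal.ofReal_mul (by positivity),
              ENNReal.ofReal_mul (p := (N : ℝ)) (by positivity), ENNReal.ofReal_natCast]
          · rw [ENNReal.ofReal_mul (p := W * (s ^ m)⁻¹) (by positivity)]
            gcongr
      _ = _ := by
          rw [← ENNReal.ofReal_add (by positivity) (by positivity)]
          congr 1
          rw [mul_pow]; ring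
  exact (ENNReal.ofReal_le_ofReal_iff (by positivity)).1 main

theorem stmt4 (d : ℕ) (hd : 1 ≤ d) :
    ∃ c : ℝ, 0 < c ∧
      ∀ (f : EuclideanSpace ℝ (Fin d) → ℝ), ContDiff ℝ 1 f →
      ∀ (N : ℕ), 0 < N →
      ∀ (x : Fin N → EuclideanSpace ℝ (Fin d)), (∀ k, x k ∈ unitCube d) →
      ∀ (W : ℝ), 0 ≤ W →
      IsInfTransportBound (empiricalMeasure d N x) (volume.restrict (unitCube d)) W →
      |(∫ y in unitCube d, f y) - (1 / N : ℝ) * ∑ k, f (x k)| ≤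
        c * (⨆ y ∈ unitCube d, ‖fderiv ℝ f y‖) ^ (((d : ℝ) - 1) / d) *
          (∫ y in unitCube d, ‖fderiv ℝ f y‖) ^ ((1 : ℝ) / d) *
          (N : ℝ) * W ^ (d + 1) := by
  obtain ⟨m, rfl⟩ : ∃ m, d = m + 1 := ⟨d - 1, by omega⟩
  have hVpos : 0 < (volume (ball (0 : EuclideanSpace ℝ (Fin (m + 1))) 1)).toReal :=
    ENNReal.toReal_pos (measure_ball_pos _ _ one_pos).ne' measure_ball_lt_top.ne
  set V := (volume (ball (0 : EuclideanSpace ℝ (Fin (m + 1))) 1)).toReal with hV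
  refine ⟨V * (1 + 2 ^ (m + 1)), by positivity, ?_⟩
  intro f hf N hN x hx W hW h
  have hg : Continuous (fderiv ℝ f) := hf.continuous_fderiv (by norm_num)
  set L := ⨆ y ∈ unitCube (m + 1), ‖fderiv ℝ f y‖ with hLdef
  have hL0 : 0 ≤ L := Real.iSup_nonneg fun y => Real.iSup_nonneg fun _ => norm_nonneg _
  have hL : ∀ y ∈ unitCube (m + 1), ‖fderiv ℝ f y‖ ≤ L := by
    obtain ⟨C, hC⟩ := (unitCube_compact (m + 1)).exists_bound_of_continuousOn hg.continuousOn
    have hb : BddAbove (Set.range fun y => ⨆ (_ : y ∈ unitCube (m + 1)), ‖fderiv ℝ f y‖) := by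
      refine ⟨max C 0, ?_⟩
      rintro _ ⟨y, rfl⟩
      exact Real.iSup_le (fun hy => (hC y hy).trans (le_max_left _ _)) (le_max_right _ _)
    intro y hy
    refine le_ciSup_of_le hb y ?_
    simp [hy]
  set I := ∫ y in unitCube (m + 1), ‖fderiv ℝ f y‖ with hI
  have hI0 : 0 ≤ I := integral_nonneg fun _ => norm_nonneg _
  have hIL : I ≤ L := by
    have hm1 := mass_one (m + 1) N hN x W h
    have := norm_setIntegral_le_of_norm_le_const (μ := volume) (s := unitCube (m + 1))
      (f := fun y => ‖fderiv ℝ f y‖) (C := L) (by rw [hm1]; simp) (by simpa using hL)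
    rw [Measure.real, hm1, ENNReal.toReal_one, mul_one] at this
    exact (le_abs_self _).trans this
  have key := fun s hs hs1 => sum_bound (m + 1) m N rfl hN x hx W hW h f hf L hL0 hL s hs hs1
  rw [← hV, ← hI] at key
  set err := |(∫ y in unitCube (m + 1), f y) - (1 / N : ℝ) * ∑ k, f (x k)| with herr
  have hm0 : (0 : ℝ) < ((m + 1 : ℕ) : ℝ) := by positivity
  rcases hI0.eq_or_lt with hI00 | hIpos
  · rw [← hI00, Real.zero_rpow (by positivity)]
    simp only [mul_zero, zero_mul]
    rw [← hI00] at key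
    simp only [mul_zero, add_zero] at key
    by_contra hcon
    push Not at hcon
    set K := V * N * W ^ (m + 1 + 1) * L with hK
    have hK0 : 0 ≤ K := by positivity
    have hs0 : 0 < min 1 (err / (2 * (K + 1))) := by positivity
    have h1 := key _ hs0 (min_le_left _ _)
    have h2 : K * min 1 (err / (2 * (K + 1))) ≤ K * (err / (2 * (K + 1))) := by
      gcongr; exact min_le_right _ _
    have h3 : K * (err / (2 * (K + 1))) < err := by
      rw [← mul_div_assoc, div_lt_iff₀ (by positivity)]
      nlinarith
    rw [← mul_assoc] at h1
    linarith
  · have hLpos : 0 < L := hIpos.trans_le hIL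
    set s := (I / L) ^ ((1 : ℝ) / ((m + 1 : ℕ) : ℝ)) with hs
    have hs0 : 0 < s := by positivity
    have hs1 : s ≤ 1 := Real.rpow_le_one (by positivity) ((div_le_one hLpos).2 hIL) (by positivity)
    have hsp : s ^ (m + 1) = I / L := by
      rw [hs, ← Real.rpow_natCast, ← Real.rpow_mul (by positivity), one_div,
        inv_mul_cancel₀ hm0.ne', Real.rpow_one]
    have e1 : (s ^ m)⁻¹ * I = L * s := by
      have : I = s ^ (m + 1) * L := by rw [hsp]; field_simp
      rw [this]; field_simp; ring
    have e2 : L * s = L ^ ((((m + 1 : ℕ) : ℝ) - 1) / ((m + 1 : ℕ) : ℝ)) *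
        I ^ ((1 : ℝ) / ((m + 1 : ℕ) : ℝ)) := by
      rw [hs, Real.div_rpow hI0 hL0, sub_div, div_self hm0.ne', Real.rpow_sub hLpos, Real.rpow_one]
      field_simp
    have := key s hs0 hs1
    rw [e1] at this
    refine this.trans (le_of_eq ?_)
    rw [e2]
    ring
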